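/- arXiv:0801.1512 — 3 statements merged into one kernel-verified Lean document; each statement's English description precedes it below -/
import Mathlib

section
/- Let Ω ⊆ ℂ be a nonempty open connected set, 0 < p < ∞, and let {f_n} be a sequence of analytic functions on Ω satisfying ∫_Ω |f_n|^p dA ≤ M^p for all n, for some constant M. Then there exist a subsequence {f_{n_k}} and a function f analytic on Ω such that f_{n_k} → f uniformly on every compact subset of Ω. -/
open MeasureTheory Metric Filter
open scoped Real Topology

theorem aux_log {f : ℂ → ℂ} {c : ℂ} {R : ℝ} (hR : 0 < R)
    (hf : AnalyticOnNhd ℂ f (closedBall c R)) (hc : f c ≠ 0) :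
    Real.log ‖f c‖ ≤ Real.circleAverage (Real.log ‖f ·‖) c R := by
  have hf' : AnalyticOnNhd ℂ f (closedBall c |R|) := by rwa [abs_of_pos hR]
  rw [hf'.circleAverage_log_norm hR.ne' hc]
  have : 0 ≤ ∑ᶠ u, (MeromorphicOn.divisor f (closedBall c |R|) u : ℝ) * Real.log (R * ‖c - u‖⁻¹) := by
    apply finsum_nonneg
    intro u
    by_cases h1 : u ∈ closedBall c |R|
    · refine mul_nonneg (mod_cast MeromorphicOn.AnalyticOnNhd.divisor_nonneg hf' u) ?_
      by_cases h : u = c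
      · simp [h]
      · have h0 : 0 < ‖c - u‖ := norm_pos_iff.mpr (sub_ne_zero.mpr (Ne.symm h))
        apply Real.log_nonneg
        rw [← div_eq_mul_inv, le_div_iff₀ h0, one_mul]
        simpa [dist_eq_norm', abs_of_pos hR] using h1
    · simp [h1]
  linarith

theorem aux_mean {f : ℂ → ℂ} {c : ℂ} {R p : ℝ} (hR : 0 < R) (hp : 0 < p)
    (hf : AnalyticOnNhd ℂ f (closedBall c R)) :
    ‖f c‖ ^ p ≤ Real.circleAverage (fun z => ‖f z‖ ^ p) c R := by
  by_cases hc : f c = 0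
  · rw [hc, norm_zero, Real.zero_rpow hp.ne', Real.circleAverage]
    have : 0 ≤ ∫ θ in (0:ℝ)..2 * π, ‖f (circleMap c R θ)‖ ^ p :=
      intervalIntegral.integral_nonneg (by positivity) (fun _ _ => by positivity)
    simp only [smul_eq_mul]
    positivity
  have hf' : AnalyticOnNhd ℂ f (closedBall c |R|) := by rwa [abs_of_pos hR]
  have h1 := aux_log hR hf hc
  set m := ‖f c‖ with hm
  have hm0 : 0 < m := norm_pos_iff.mpr hc
  have hmp : 0 < m ^ p := Real.rpow_pos_of_pos hm0 p
  let L : ℂ → ℝ := fun z => if f z = 0 then (-1 + p * Real.log m) / p else Real.log ‖f z‖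
  have hcod : (fun z => Real.log ‖f z‖) =ᶠ[codiscreteWithin (sphere c |R|)] L := by
    rcases hf'.eqOn_zero_or_eventually_ne_zero_of_preconnected
      (convex_closedBall c |R|).isPreconnected with h | h
    · exact absurd (h (mem_closedBall_self (abs_nonneg R))) hc
    · have := codiscreteWithin_mono (sphere_subset_closedBall (x := c) (ε := |R|)) h
      filter_upwards [this] with z hz
      have hz' : f z ≠ 0 := hz
      simp [L, hz']
  have hLi : CircleIntegrable (fun z => Real.log ‖f z‖) c R :=
    (hf'.mono sphere_subset_closedBall).meromorphicOn.circleIntegrable_log_norm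
  have hLi' : CircleIntegrable L c R := hLi.congr_codiscreteWithin hcod
  have hav := Real.circleAverage_congr_codiscreteWithin hcod hR.ne'
  have hGc : ContinuousOn (fun z => ‖f z‖ ^ p) (sphere c R) :=
    ((hf.continuousOn.mono sphere_subset_closedBall).norm).rpow_const (fun _ _ => Or.inr hp.le)
  have hGi : CircleIntegrable (fun z => ‖f z‖ ^ p) c R := hGc.circleIntegrable hR.le
  have hle : Real.circleAverage L c R ≤
      Real.circleAverage (fun z => (p * m ^ p)⁻¹ • ‖f z‖ ^ p + (-1 + p * Real.log m) / p) c R := by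
    apply Real.circleAverage_mono hLi'
    · exact (hGi.const_smul (a := (p * m ^ p)⁻¹)).add (circleIntegrable_const _ c R)
    · intro z _
      by_cases hz : f z = 0
      · simp only [L, hz, if_true, smul_eq_mul, norm_zero]
        have : (0:ℝ) ≤ (p * m ^ p)⁻¹ * 0 ^ p := by positivity
        linarith
      · simp only [L, hz, if_false, smul_eq_mul]
        have hz0 : 0 < ‖f z‖ := norm_pos_iff.mpr hz
        have h2 := Real.log_le_sub_one_of_pos (x := ‖f z‖ ^ p / m ^ p) (by positivity)
        rw [Real.log_div (by positivity) (by positivity), Real.log_rpow hz0, Real.log_rpow hm0] at h2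
        have : (p * m ^ p)⁻¹ * ‖f z‖ ^ p + (-1 + p * Real.log m) / p
          = (‖f z‖ ^ p / m ^ p - 1 + p * Real.log m) / p := by field_simp; ring
        rw [this, le_div_iff₀ hp]
        linarith
  have hadd := Real.circleAverage_fun_add (f₁ := fun z => (p * m ^ p)⁻¹ • ‖f z‖ ^ p)
    (f₂ := fun _ => (-1 + p * Real.log m) / p) (hGi.const_smul (a := (p * m ^ p)⁻¹))
    (circleIntegrable_const _ c R)
  rw [hadd, Real.circleAverage_const, Real.circleAverage_fun_smul] at hle
  have h3 : Real.log m ≤ (p * m ^ p)⁻¹ * Real.circleAverage (fun z => ‖f z‖ ^ p) c R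
      + (-1 + p * Real.log m) / p := by
    calc _ ≤ _ := h1
      _ = _ := hav
      _ ≤ _ := hle
  set A := Real.circleAverage (fun z => ‖f z‖ ^ p) c R
  have : (p * m ^ p)⁻¹ * A + (-1 + p * Real.log m) / p
     = Real.log m + (A / m ^ p - 1) / p := by field_simp; ring
  rw [this] at h3
  have h4 : 0 ≤ (A / m ^ p - 1) / p := by linarith
  have h5 : 0 ≤ A / m ^ p - 1 := by
    by_contra h
    have := div_neg_of_neg_of_pos (not_le.mp h) hp
    linarith
  have : 1 ≤ A / m ^ p := by linarith
  rwa [le_div_iff₀ hmp, one_mul] at this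

theorem aux_theta {f : ℂ → ℂ} {a : ℂ} {r s p : ℝ} (hp : 0 < p) (hs : 0 < s) (hsr : s < r)
    (hf : AnalyticOnNhd ℂ f (ball a r)) :
    ENNReal.ofReal (2 * π * ‖f a‖ ^ p) ≤
      ∫⁻ θ in Set.Ioo (-π) π, ENNReal.ofReal (‖f (circleMap a s θ)‖ ^ p) := by
  have hmean := aux_mean hs hp (hf.mono (closedBall_subset_ball hsr))
  have hc : Continuous (fun θ => ‖f (circleMap a s θ)‖ ^ p) := by
    have : Continuous (fun θ => f (circleMap a s θ)) :=
      hf.continuousOn.comp_continuous (continuous_circleMap a s) (fun θ => by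
        simp [mem_ball, dist_eq_norm, circleMap_sub_center, abs_of_pos hs, hsr])
    exact this.norm.rpow_const (fun _ => Or.inr hp.le)
  rw [Real.circleAverage_eq_integral_add (-π),
    intervalIntegral.integral_comp_add_right (fun θ ↦ ‖f (circleMap a s θ)‖ ^ p)] at hmean
  rw [show (0:ℝ) + -π = -π by ring, show 2 * π + -π = π by ring, smul_eq_mul,
    ← div_eq_inv_mul, le_div_iff₀ (by positivity)] at hmean
  rw [← ofReal_integral_eq_lintegral_ofReal]
  · apply ENNReal.ofReal_le_ofReal
    rw [← integral_Ioc_eq_integral_Ioo, ← intervalIntegral.integral_of_le (by linarith [Real.pi_pos])]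
    linarith
  · exact (hc.integrableOn_Icc (a := -π) (b := π)).mono_set Set.Ioo_subset_Icc_self
  · exact Eventually.of_forall (fun _ => by positivity)

theorem aux_area {f : ℂ → ℂ} {a : ℂ} {r p : ℝ} (hp : 0 < p) (hr : 0 < r)
    (hf : AnalyticOnNhd ℂ f (ball a r)) :
    ENNReal.ofReal ((r / 2) * (2 * π * ‖f a‖ ^ p)) * ENNReal.ofReal (r / 2) ≤
      ∫⁻ z in ball a r, ENNReal.ofReal (‖f z‖ ^ p) := by
  set h : ℂ → ENNReal := (ball a r).indicator (fun z => ENNReal.ofReal (‖f z‖ ^ p)) with hh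
  have hm : Measurable h := by
    classical
    have hcont : ContinuousOn (fun z => ENNReal.ofReal (‖f z‖ ^ p)) (ball a r) :=
      ENNReal.continuous_ofReal.comp_continuousOn
        (hf.continuousOn.norm.rpow_const (fun _ _ => Or.inr hp.le))
    rw [hh, ← Set.piecewise_eq_indicator]
    exact hcont.measurable_piecewise continuousOn_const isOpen_ball.measurableSet
  have hpol : Measurable (fun q : ℝ × ℝ => ENNReal.ofReal q.1 * h (circleMap a q.1 q.2)) := by
    have : Continuous (fun q : ℝ × ℝ => circleMap a q.1 q.2) := by
      unfold circleMap; fun_prop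
    exact (measurable_fst.ennreal_ofReal).mul (hm.comp this.measurable)
  rw [← lintegral_indicator isOpen_ball.measurableSet, ← hh, ← lintegral_add_right_eq_self h a,
    ← Complex.lintegral_comp_polarCoord_symm]
  have e1 : ∀ q : ℝ × ℝ, ENNReal.ofReal q.1 • h (Complex.polarCoord.symm q + a)
      = ENNReal.ofReal q.1 * h (circleMap a q.1 q.2) := by
    intro q
    rw [Complex.polarCoord_symm_apply, circleMap, Complex.exp_mul_I, smul_eq_mul, add_comm a]
    simp
  simp_rw [e1]
  rw [show polarCoord.target = Set.Ioi (0 : ℝ) ×ˢ Set.Ioo (-π) π from rfl, Measure.volume_eq_prod,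
    setLIntegral_prod _ hpol.aemeasurable]
  calc _ = ∫⁻ s in Set.Ioo (r/2) r, ENNReal.ofReal ((r / 2) * (2 * π * ‖f a‖ ^ p)) := by
        rw [setLIntegral_const, Real.volume_Ioo]; congr 2; ring
    _ ≤ ∫⁻ s in Set.Ioo (r/2) r, ∫⁻ θ in Set.Ioo (-π) π, ENNReal.ofReal s * h (circleMap a s θ) := by
        apply setLIntegral_mono' measurableSet_Ioo
        intro s hs
        have hs0 : 0 < s := by linarith [hs.1]
        rw [lintegral_const_mul' _ _ ENNReal.ofReal_ne_top, ENNReal.ofReal_mul (by positivity)]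
        gcongr
        · exact hs.1.le
        · refine (aux_theta hp hs0 hs.2 hf).trans (le_of_eq ?_)
          congr 1 with θ
          rw [hh, Set.indicator_of_mem]
          simp [mem_ball, dist_eq_norm, circleMap_sub_center, abs_of_pos hs0, hs.2]
    _ ≤ _ := by
        apply lintegral_mono_set
        intro s hs
        have : 0 < s := by linarith [hs.1]
        exact this

theorem aux_bound {Ω : Set ℂ} (hΩ : IsOpen Ω) {p M : ℝ} (hp : 0 < p) {f : ℂ → ℂ}
    (hf : DifferentiableOn ℂ f Ω) (hint : IntegrableOn (fun z => ‖f z‖ ^ p) Ω)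
    (hb : ∫ z in Ω, ‖f z‖ ^ p ≤ M ^ p) {a : ℂ} {r : ℝ} (hr : 0 < r) (hsub : ball a r ⊆ Ω) :
    ‖f a‖ ≤ (M ^ p / (r ^ 2 * π / 2)) ^ p⁻¹ := by
  have hA : AnalyticOnNhd ℂ f (ball a r) := (hf.analyticOnNhd hΩ).mono hsub
  have h1 := (aux_area hp hr hA).trans (lintegral_mono_set hsub)
  rw [← ofReal_integral_eq_lintegral_ofReal hint (Eventually.of_forall fun _ => by positivity),
    ← ENNReal.ofReal_mul (by positivity), ENNReal.ofReal_le_ofReal_iff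
    (integral_nonneg fun _ => by positivity)] at h1
  have h2 : ‖f a‖ ^ p ≤ M ^ p / (r ^ 2 * π / 2) := by
    rw [le_div_iff₀ (by positivity)]
    linarith
  calc ‖f a‖ = (‖f a‖ ^ p) ^ p⁻¹ := (Real.rpow_rpow_inv (norm_nonneg _) hp.ne').symm
    _ ≤ _ := Real.rpow_le_rpow (by positivity) h2 (by positivity)

theorem aux_montel {Ω : Set ℂ} (hΩ : IsOpen Ω) {F : ℕ → ℂ → ℂ}
    (hF : ∀ n, DifferentiableOn ℂ (F n) Ω)
    (hb : ∀ a ∈ Ω, ∃ r > 0, ball a r ⊆ Ω ∧ ∃ C : ℝ, ∀ n, ∀ z ∈ ball a r, ‖F n z‖ ≤ C) :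
    ∃ (φ : ℕ → ℕ) (f : ℂ → ℂ), StrictMono φ ∧ DifferentiableOn ℂ f Ω ∧
      ∀ K : Set ℂ, K ⊆ Ω → IsCompact K →
        TendstoUniformlyOn (fun k => F (φ k)) f atTop K := by
  classical
  have : LocallyCompactSpace Ω := hΩ.locallyCompactSpace
  let G : ℕ → C(Ω, ℂ) := fun n => ⟨Ω.domRestrict (F n), (hF n).continuousOn.domRestrict⟩
  have hGapp : ∀ n (x : Ω), G n x = F n x := fun n x => rfl
  have hequi : Equicontinuous (fun n => (G n : Ω → ℂ)) := by
    intro x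
    obtain ⟨r, hr, hsub, C, hC⟩ := hb x x.2
    rw [Metric.equicontinuousAt_iff_right]
    intro ε hε
    have hC0 : 0 ≤ C := (norm_nonneg _).trans (hC 0 x (mem_ball_self hr))
    have : Tendsto (fun y : Ω => 2 * C / r * dist (y : ℂ) x) (𝓝 x) (𝓝 0) := by
      have : Continuous (fun y : Ω => 2 * C / r * dist (y : ℂ) x) := by fun_prop
      simpa using this.tendsto x
    have h2 : ∀ᶠ y : Ω in 𝓝 x, (y : ℂ) ∈ ball (x : ℂ) r :=
      continuous_subtype_val.continuousAt.eventually (ball_mem_nhds _ hr)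
    filter_upwards [this.eventually_lt_const hε, h2] with y hy hy2 n
    rw [hGapp, hGapp, dist_comm]
    refine lt_of_le_of_lt (Complex.dist_le_div_mul_dist_of_mapsTo_ball ((hF n).mono hsub) ?_ hy2) hy
    intro z hz
    rw [mem_closedBall, dist_eq_norm]
    have := norm_sub_le (F n z) (F n x)
    linarith [hC n z hz, hC n x (mem_ball_self hr)]
  have hT2 : T2Space (UniformOnFun Ω ℂ {K : Set Ω | IsCompact K}) :=
    UniformOnFun.t2Space_of_covering (Set.eq_univ_iff_forall.mpr fun x =>
      Set.mem_sUnion_of_mem (Set.mem_singleton x) isCompact_singleton)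
  have hcomp : IsCompact (closure (Set.range G)) := by
    apply ArzelaAscoli.isCompact_closure_of_isClosedEmbedding (ι := C(Ω, ℂ)) (X := Ω) (α := ℂ)
      (F := fun g => (g : Ω → ℂ)) (𝔖 := {K : Set Ω | IsCompact K}) (fun K hK => hK)
      ContinuousMap.isUniformEmbedding_toUniformOnFunIsCompact.isClosedEmbedding
    · intro K _
      apply Equicontinuous.equicontinuousOn
      intro x U hU
      filter_upwards [hequi x U hU] with y hy
      rintro ⟨_, n, rfl⟩
      exact hy n
    · intro K _ x _
      obtain ⟨r, hr, hsub, C, hC⟩ := hb x x.2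
      refine ⟨closedBall 0 C, isCompact_closedBall _ _, ?_⟩
      rintro _ ⟨n, rfl⟩
      simpa [hGapp] using hC n x (mem_ball_self hr)
  obtain ⟨g, -, φ, hφ, hlim⟩ := hcomp.tendsto_subseq (x := G) (fun n => subset_closure ⟨n, rfl⟩)
  rw [ContinuousMap.tendsto_iff_forall_isCompact_tendstoUniformlyOn] at hlim
  let f : ℂ → ℂ := fun z => if h : z ∈ Ω then g ⟨z, h⟩ else 0
  have key : ∀ K : Set ℂ, K ⊆ Ω → IsCompact K →
        TendstoUniformlyOn (fun k => F (φ k)) f atTop K := by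
    intro K hK hKc
    have hK' : IsCompact ((↑) ⁻¹' K : Set Ω) := by
      rw [Topology.IsInducing.subtypeVal.isCompact_iff, Subtype.image_preimage_coe,
        Set.inter_eq_self_of_subset_right hK]
      exact hKc
    intro u hu
    filter_upwards [hlim _ hK' u hu] with n hn z hz
    have := hn ⟨z, hK hz⟩ hz
    simpa [f, hK hz, hGapp] using this
  refine ⟨φ, f, hφ, ?_, key⟩
  have hloc : TendstoLocallyUniformlyOn (fun k => F (φ k)) f atTop Ω :=
    (tendstoLocallyUniformlyOn_iff_forall_isCompact hΩ).2 key
  exact hloc.differentiableOn (Eventually.of_forall fun n => hF (φ n)) hΩ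

/-- Normal-families property of bounded sequences in `A^p(Ω)`: if `f_n` are analytic on the
nonempty open connected set `Ω ⊆ ℂ` with `∫_Ω |f_n|^p dA ≤ M^p` for all `n`, then some
subsequence converges uniformly on every compact subset of `Ω` to a function analytic on `Ω`. -/
theorem bounded_Ap_sequence_has_locally_uniformly_convergent_subsequence
    (Ω : Set ℂ) (hΩ : IsOpen Ω) (hne : Ω.Nonempty) (hconn : IsConnected Ω)
    (p : ℝ) (hp : 0 < p) (M : ℝ) (hM : 0 ≤ M) (F : ℕ → ℂ → ℂ)
    (hF : ∀ n, DifferentiableOn ℂ (F n) Ω)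
    (hFint : ∀ n, IntegrableOn (fun z => ‖F n z‖ ^ p) Ω)
    (hbdd : ∀ n, ∫ z in Ω, ‖F n z‖ ^ p ≤ M ^ p) :
    ∃ (φ : ℕ → ℕ) (f : ℂ → ℂ), StrictMono φ ∧ DifferentiableOn ℂ f Ω ∧
      ∀ K : Set ℂ, K ⊆ Ω → IsCompact K →
        TendstoUniformlyOn (fun k => F (φ k)) f atTop K := by
  apply aux_montel hΩ hF
  intro a ha
  obtain ⟨r, hr, hsub⟩ := Metric.isOpen_iff.1 hΩ a ha
  refine ⟨r / 2, by positivity, (ball_subset_ball (by linarith)).trans hsub,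
    (M ^ p / ((r / 2) ^ 2 * π / 2)) ^ p⁻¹, fun n z hz => ?_⟩
  refine aux_bound hΩ hp (hF n) (hFint n) (hbdd n) (by positivity) (Set.Subset.trans ?_ hsub)
  apply ball_subset_ball'
  have := mem_ball.1 hz
  linarith
end

section
/- Let Ω = Δ ∖ [0, 1), the unit disc with the radial slit [0,1) removed, and let f : Ω → ℂ be the analytic branch of the square root on Ω given by f(z) = i·√(-z), where √ denotes the principal square root (so f(z)^2 = z on Ω). Then f ∈ A^2(Ω), but there exists no sequence of polynomials {P_n} with ∫_Ω |f(z) - P_n(z)|^2 dA(z) → 0; that is, the polynomials are not dense in A^2(Ω). -/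
open MeasureTheory Metric Filter
open scoped Real Topology

lemma slit_cpow_int (a : ℝ) (ha : 0 < a) :
    ∫ z in ball (0 : ℂ) 1, z ^ (a : ℂ) = ((1 / (a + 2) * (2 * Real.sin (a * π) / a) : ℝ) : ℂ) := by
  rw [← integral_indicator measurableSet_ball, ← Complex.integral_comp_polarCoord_symm]
  have h1 : ∀ p ∈ polarCoord.target,
      p.1 • (ball (0 : ℂ) 1).indicator (fun z : ℂ => z ^ (a : ℂ)) (Complex.polarCoord.symm p)
      = (Set.Iio (1 : ℝ)).indicator (fun r : ℝ => ((r ^ (a + 1) : ℝ) : ℂ)) p.1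
        * Complex.exp ((Complex.I * a) * (p.2 : ℂ)) := by
    rintro ⟨r, t⟩ hp
    simp only [polarCoord_target, Set.mem_prod, Set.mem_Ioi, Set.mem_Ioo] at hp
    obtain ⟨hr, ht⟩ := hp
    have hz : Complex.polarCoord.symm (r, t) = r * (Complex.cos t + Complex.sin t * Complex.I) := by
      simp [Complex.polarCoord_symm_apply]
    have hn : ‖Complex.polarCoord.symm (r, t)‖ = r := by
      rw [Complex.norm_polarCoord_symm]; exact abs_of_pos hr
    have harg : (Complex.polarCoord.symm (r, t)).arg = t := by
      rw [hz, Complex.arg_mul_cos_add_sin_mul_I hr ⟨ht.1, ht.2.le⟩]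
    have hne : Complex.polarCoord.symm (r, t) ≠ 0 := by
      rw [← norm_ne_zero_iff, hn]; exact hr.ne'
    by_cases h : r < 1
    · rw [Set.indicator_of_mem (by rw [mem_ball_zero_iff, hn]; exact h), Set.indicator_of_mem (by simpa using h)]
      rw [Complex.cpow_def_of_ne_zero hne, Complex.log, hn, harg, add_mul, Complex.exp_add,
        Real.rpow_add hr, Real.rpow_one, Real.rpow_def_of_pos hr]
      simp only [Complex.real_smul]
      push_cast
      rw [show (t : ℂ) * Complex.I * a = Complex.I * a * t by ring]
      ring
    · rw [Set.indicator_of_notMem (by rw [mem_ball_zero_iff, hn]; exact h),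
        Set.indicator_of_notMem (by simpa using h)]
      simp
  have hm : MeasurableSet polarCoord.target := polarCoord.open_target.measurableSet
  rw [setIntegral_congr_fun hm h1, polarCoord_target, Measure.volume_eq_prod,
    setIntegral_prod_mul (μ := (volume : Measure ℝ)) (ν := (volume : Measure ℝ))
      ((Set.Iio (1 : ℝ)).indicator (fun r : ℝ => ((r ^ (a + 1) : ℝ) : ℂ)))
      (fun t : ℝ => Complex.exp ((Complex.I * a) * (t : ℂ)))]
  have hA : ∫ x in Set.Ioi (0:ℝ), (Set.Iio (1 : ℝ)).indicator
      (fun r : ℝ => ((r ^ (a + 1) : ℝ) : ℂ)) x = ((1 / (a + 2) : ℝ) : ℂ) := by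
    rw [setIntegral_indicator measurableSet_Iio, Set.Ioi_inter_Iio, ← integral_Ioc_eq_integral_Ioo,
      ← intervalIntegral.integral_of_le zero_le_one, intervalIntegral.integral_ofReal,
      integral_rpow (Or.inl (by linarith))]
    rw [Real.one_rpow, Real.zero_rpow (by linarith)]
    congr 1; ring_nf
  have hB : ∫ t in Set.Ioo (-π) π, Complex.exp ((Complex.I * a) * (t : ℂ))
      = ((2 * Real.sin (a * π) / a : ℝ) : ℂ) := by
    have ha' : (a : ℂ) ≠ 0 := by exact_mod_cast ha.ne'
    rw [← integral_Ioc_eq_integral_Ioo,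
      ← intervalIntegral.integral_of_le (by linarith [Real.pi_pos]),
      integral_exp_mul_complex (mul_ne_zero Complex.I_ne_zero ha')]
    push_cast
    rw [Complex.sin]
    rw [show Complex.I * a * (-(π:ℂ)) = -(a * π) * Complex.I by ring,
      show Complex.I * a * (π:ℂ) = (a * π) * Complex.I by ring]
    rw [show Complex.exp (-(a * π) * Complex.I) = Complex.exp (-(a * π * Complex.I)) by ring_nf]
    field_simp
    linear_combination (Complex.exp ((a * π) * Complex.I) - Complex.exp (-(a * π * Complex.I))) * Complex.I_sq
  rw [hA, hB]
  push_cast; rfl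

lemma slit_ae : (ball (0 : ℂ) 1 \ (Complex.ofReal '' Set.Ico (0 : ℝ) 1) : Set ℂ)
    =ᵐ[volume] ball (0 : ℂ) 1 := by
  apply sdiff_null_ae_eq_self
  have h := Measure.addHaar_submodule (volume : Measure ℂ) (LinearMap.ker Complex.imLm) (by
    intro h
    have : Complex.I ∈ LinearMap.ker Complex.imLm := by rw [h]; trivial
    simp at this)
  refine measure_mono_null ?_ h
  rintro _ ⟨x, -, rfl⟩
  simp

lemma slit_poly (P : Polynomial ℂ) : ∫ z in ball (0 : ℂ) 1, P.eval z * z = 0 := by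
  simp_rw [Polynomial.eval_eq_sum_range, Finset.sum_mul]
  rw [integral_finsetSum]
  · refine Finset.sum_eq_zero fun i _ => ?_
    simp_rw [mul_assoc, ← pow_succ]
    rw [integral_const_mul]
    have := slit_cpow_int ((i + 1 : ℕ) : ℝ) (by positivity)
    rw [Real.sin_nat_mul_pi] at this
    simp only [Complex.ofReal_natCast, Complex.cpow_natCast] at this
    rw [this]; simp
  · intro i _
    exact (Continuous.continuousOn (by fun_prop)).integrableOn_compact (isCompact_closedBall (0:ℂ) 1)
      |>.mono_set ball_subset_closedBall

lemma slit_meas : Measurable (fun z : ℂ => Complex.I * (-z) ^ ((1 : ℂ) / 2)) := by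
  fun_prop

lemma slit_bound (z : ℂ) (hz : z ∈ ball (0 : ℂ) 1) :
    ‖Complex.I * (-z) ^ ((1 : ℂ) / 2)‖ ≤ 1 := by
  rw [mem_ball_zero_iff] at hz
  have h : ((1 : ℂ) / 2) = ((1 / 2 : ℝ) : ℂ) := by push_cast; rfl
  rw [norm_mul, Complex.norm_I, one_mul, h, Complex.norm_cpow_real, norm_neg]
  exact Real.rpow_le_one (norm_nonneg _) hz.le (by norm_num)

lemma slit_intble {E : Type} [NormedAddCommGroup E] {g : ℂ → E}
    (hg : AEStronglyMeasurable g (volume : Measure ℂ))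
    (C : ℝ) (hC : ∀ z ∈ ball (0 : ℂ) 1, ‖g z‖ ≤ C) : IntegrableOn g (ball (0 : ℂ) 1) :=
  Measure.integrableOn_of_bounded measure_ball_lt_top.ne hg
    ((ae_restrict_iff' measurableSet_ball).2 (Eventually.of_forall hC))

lemma slit_f : ∫ z in ball (0 : ℂ) 1, (Complex.I * (-z) ^ ((1 : ℂ) / 2)) * z
    = Complex.I * (8 / 21) := by
  have h := slit_cpow_int (3/2) (by norm_num)
  have hs : Real.sin (3/2 * π) = -1 := by
    rw [show 3/2 * π = π / 2 + π by ring, Real.sin_add_pi, Real.sin_pi_div_two]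
  rw [hs] at h
  have h2 : ∫ z in ball (0 : ℂ) 1, (Complex.I * (-z) ^ ((1 : ℂ) / 2)) * z
     = ∫ z in ball (0 : ℂ) 1, -Complex.I * z ^ (((3/2 : ℝ)) : ℂ) := by
    rw [← integral_indicator measurableSet_ball, ← integral_indicator measurableSet_ball,
      ← integral_neg_eq_self]
    congr 1; ext z
    by_cases hz : z ∈ ball (0:ℂ) 1
    · rw [Set.indicator_of_mem hz, Set.indicator_of_mem (by simpa using hz)]
      by_cases h0 : z = 0
      · subst h0; simp
      · rw [show (((3/2 : ℝ)) : ℂ) = 1/2 + 1 by push_cast; norm_num, Complex.cpow_add _ _ h0]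
        simp; ring
    · rw [Set.indicator_of_notMem hz, Set.indicator_of_notMem (by simpa using hz)]
  rw [h2, integral_const_mul, h]
  push_cast; ring

/-- On the slit disc `Ω = Δ \ [0,1)`, the analytic square root `f(z) = i·√(-z)` (principal
branch) belongs to `A²(Ω)`, but cannot be approximated by polynomials in the `A²(Ω)` norm:
the polynomials are not dense in `A²(Ω)`. -/
theorem polynomials_not_dense_in_slit_disc :
    DifferentiableOn ℂ (fun z : ℂ => Complex.I * (-z) ^ ((1 : ℂ) / 2))
      (ball (0 : ℂ) 1 \ (Complex.ofReal '' Set.Ico (0 : ℝ) 1)) ∧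
    IntegrableOn (fun z : ℂ => ‖Complex.I * (-z) ^ ((1 : ℂ) / 2)‖ ^ 2)
      (ball (0 : ℂ) 1 \ (Complex.ofReal '' Set.Ico (0 : ℝ) 1)) ∧
    ¬ ∃ P : ℕ → Polynomial ℂ,
      Tendsto
        (fun n =>
          ∫ z in ball (0 : ℂ) 1 \ (Complex.ofReal '' Set.Ico (0 : ℝ) 1),
            ‖Complex.I * (-z) ^ ((1 : ℂ) / 2) - (P n).eval z‖ ^ 2)
        atTop (𝓝 0) := by
  have hcontInt : ∀ {E : Type} [NormedAddCommGroup E] {g : ℂ → E}, Continuous g →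
      IntegrableOn g (ball (0:ℂ) 1) := fun {E} _ {g} hg =>
    (hg.continuousOn.integrableOn_compact (isCompact_closedBall (0:ℂ) 1)).mono_set
      ball_subset_closedBall
  refine ⟨?_, ?_, ?_⟩
  · intro z hz
    apply DifferentiableAt.differentiableWithinAt
    refine DifferentiableAt.const_mul ?_ _
    refine DifferentiableAt.cpow_const (by fun_prop) ?_
    by_contra hns
    rw [Complex.mem_slitPlane_iff] at hns
    push Not at hns
    simp only [Complex.neg_re, Complex.neg_im, neg_eq_zero, Left.neg_nonpos_iff] at hns
    have hzz : z = (z.re : ℂ) := Complex.ext (by simp) (by simp [hns.2])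
    refine hz.2 ⟨z.re, ⟨hns.1, ?_⟩, hzz.symm⟩
    have := hz.1
    rw [mem_ball_zero_iff] at this
    exact (Complex.re_le_norm z).trans_lt this
  · exact (slit_intble (slit_meas.norm.pow_const 2).aestronglyMeasurable 1 (fun z hz => by
      rw [norm_pow, norm_norm]; exact pow_le_one₀ (norm_nonneg _) (slit_bound z hz))).mono_set Set.sdiff_subset
  · rintro ⟨P, hP⟩
    simp_rw [setIntegral_congr_set slit_ae] at hP
    have key : ∀ n, (8/21 : ℝ) ≤ π / 20 + 5 * ∫ z in ball (0:ℂ) 1,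
        ‖Complex.I * (-z) ^ ((1 : ℂ) / 2) - (P n).eval z‖ ^ 2 := by
      intro n
      have hp : Continuous (fun z : ℂ => (P n).eval z) := (P n).continuous
      obtain ⟨C, hC⟩ := (isCompact_closedBall (0:ℂ) 1).exists_bound_of_continuousOn hp.continuousOn
      have i1 : IntegrableOn (fun z : ℂ => (Complex.I * (-z) ^ ((1 : ℂ) / 2)) * z)
          (ball (0:ℂ) 1) := by
        refine slit_intble (slit_meas.mul measurable_id).aestronglyMeasurable 1 fun z hz => ?_
        rw [norm_mul]
        exact mul_le_one₀ (slit_bound z hz) (norm_nonneg _) (mem_ball_zero_iff.1 hz).le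
      have i2 : IntegrableOn (fun z : ℂ => (P n).eval z * z) (ball (0:ℂ) 1) :=
        hcontInt (hp.mul continuous_id)
      have i3 : IntegrableOn (fun z : ℂ => ‖Complex.I * (-z) ^ ((1 : ℂ) / 2) - (P n).eval z‖ ^ 2)
          (ball (0:ℂ) 1) := by
        refine slit_intble ((slit_meas.sub hp.measurable).norm.pow_const 2).aestronglyMeasurable
          ((1 + C) ^ 2) fun z hz => ?_
        rw [norm_pow, norm_norm]
        refine pow_le_pow_left₀ (norm_nonneg _) ((norm_sub_le _ _).trans ?_) 2
        exact add_le_add (slit_bound z hz) (hC z (ball_subset_closedBall hz))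
      have i4 : IntegrableOn (fun z : ℂ => (1/20 : ℝ)) (ball (0:ℂ) 1) := hcontInt continuous_const
      have i5 : IntegrableOn (fun z : ℂ =>
          (Complex.I * (-z) ^ ((1 : ℂ) / 2) - (P n).eval z) * z) (ball (0:ℂ) 1) := by
        simp_rw [sub_mul]
        exact i1.sub i2
      have e1 : ∫ z in ball (0:ℂ) 1,
          (Complex.I * (-z) ^ ((1 : ℂ) / 2) - (P n).eval z) * z = Complex.I * (8/21) := by
        simp_rw [sub_mul]
        rw [integral_sub i1 i2,
          slit_f, slit_poly, sub_zero]
      have e2 : ‖Complex.I * (8/21 : ℂ)‖ = 8/21 := by simp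
      rw [← e2, ← e1]
      refine (norm_integral_le_integral_norm _).trans ?_
      have e3 : ∫ z in ball (0:ℂ) 1, ((1/20 : ℝ) + 5 *
          ‖Complex.I * (-z) ^ ((1 : ℂ) / 2) - (P n).eval z‖ ^ 2) = π / 20 + 5 *
          ∫ z in ball (0:ℂ) 1, ‖Complex.I * (-z) ^ ((1 : ℂ) / 2) - (P n).eval z‖ ^ 2 := by
        rw [integral_add i4 (i3.const_mul 5),
          integral_const_mul, setIntegral_const]
        congr 1
        simp [Measure.real, Complex.volume_ball]
        ring
      rw [← e3]
      refine setIntegral_mono_on i5.norm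
        (i4.add (i3.const_mul 5)) measurableSet_ball ?_
      intro z hz
      rw [mem_ball_zero_iff] at hz
      rw [norm_mul]
      set u := ‖Complex.I * (-z) ^ ((1 : ℂ) / 2) - (P n).eval z‖
      have : 0 ≤ u := norm_nonneg _
      nlinarith [sq_nonneg (10 * u - 1), mul_le_mul_of_nonneg_left hz.le this]
    have hl := ge_of_tendsto' ((hP.const_mul 5).const_add (π/20)) key
    linarith [Real.pi_lt_four]
end

section
/- Let n ≥ 1 be an integer, 1 ≤ p < ∞, and let f be analytic on the unit disc Δ. Then f ∈ A^p(Δ) if and only if the function z ↦ (1 - |z|^2)^n f^{(n)}(z) belongs to L^p(Δ, dm), i.e. if and only if ∫_Δ (1 - |z|^2)^{np} |f^{(n)}(z)|^p dm(z) < ∞. -/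
open MeasureTheory Metric
open scoped Real

lemma meas_ind {s : Set ℂ} (hs : IsOpen s) {φ : ℂ → ℝ} (hφ : ContinuousOn φ s) :
    Measurable (s.indicator (fun z => ENNReal.ofReal (φ z))) := by
  classical
  have h : Measurable (s.indicator φ) := by
    have := ContinuousOn.measurable_piecewise (f := φ) (g := (0 : ℂ → ℝ)) (s := s) hφ
      continuous_zero.continuousOn hs.measurableSet
    rwa [Set.piecewise_eq_indicator] at this
  have h2 : s.indicator (fun z => ENNReal.ofReal (φ z))
      = fun z => ENNReal.ofReal (s.indicator φ z) := by
    ext z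
    by_cases hz : z ∈ s <;> simp [hz]
  rw [h2]
  exact h.ennreal_ofReal

lemma polar_annulus {G : ℂ → ENNReal} (hG : Measurable G) {a b : ℝ} (ha : 0 ≤ a) :
    ∫⁻ z in {z : ℂ | a < ‖z‖ ∧ ‖z‖ < b}, G z =
      ∫⁻ θ in Set.Ioo (-π) π, ∫⁻ r in Set.Ioo a b, ENNReal.ofReal r * G (circleMap 0 r θ) := by
  have hA : MeasurableSet {z : ℂ | a < ‖z‖ ∧ ‖z‖ < b} :=
    (measurableSet_lt measurable_const measurable_norm).inter
      (measurableSet_lt measurable_norm measurable_const)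
  have hcm : Measurable (fun q : ℝ × ℝ => circleMap 0 q.1 q.2) := by
    unfold circleMap; fun_prop
  have hm : Measurable (fun q : ℝ × ℝ => ENNReal.ofReal q.1 * G (circleMap 0 q.1 q.2)) :=
    (by fun_prop : Measurable (fun q : ℝ × ℝ => ENNReal.ofReal q.1)).mul (hG.comp hcm)
  rw [← lintegral_indicator hA, ← Complex.lintegral_comp_polarCoord_symm]
  have e1 : ∫⁻ q in polarCoord.target, ENNReal.ofReal q.1 •
      ({z : ℂ | a < ‖z‖ ∧ ‖z‖ < b}.indicator G) (Complex.polarCoord.symm q) =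
      ∫⁻ q in Set.Ioi (0:ℝ) ×ˢ Set.Ioo (-π) π, (Set.Ioo a b ×ˢ Set.univ).indicator
        (fun q : ℝ × ℝ => ENNReal.ofReal q.1 * G (circleMap 0 q.1 q.2)) q := by
    apply setLIntegral_congr_fun (measurableSet_Ioi.prod measurableSet_Ioo)
    rintro ⟨r, θ⟩ hq
    have hr : 0 < r := hq.1
    have e : Complex.polarCoord.symm (r, θ) = circleMap 0 r θ := by
      simp [circleMap, Complex.exp_mul_I]
    have hn : ‖circleMap 0 r θ‖ = r := by simp [abs_of_pos hr]
    simp only [e, Set.indicator, Set.mem_prod, Set.mem_univ, and_true, Set.mem_Ioo, hn,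
      smul_eq_mul, Set.mem_ofPred_eq, mul_ite, mul_zero]
  rw [e1, setLIntegral_indicator (measurableSet_Ioo.prod MeasurableSet.univ)]
  have e2 : (Set.Ioo a b ×ˢ Set.univ) ∩ (Set.Ioi (0:ℝ) ×ˢ Set.Ioo (-π) π)
      = Set.Ioo a b ×ˢ Set.Ioo (-π) π := by
    ext ⟨r, θ⟩
    simp only [Set.mem_inter_iff, Set.mem_prod, Set.mem_Ioo, Set.mem_univ, Set.mem_Ioi]
    constructor
    · tauto
    · rintro ⟨h1, h2⟩
      exact ⟨⟨h1, trivial⟩, ha.trans_lt h1.1, h2⟩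
  rw [e2, Measure.volume_eq_prod, ← Measure.prod_restrict, lintegral_prod_symm _ hm.aemeasurable]

lemma circle_submean {g : ℂ → ℂ} {w : ℂ} {t s : ℝ} (ht : 0 < t) (hts : t < s) {p : ℝ} (hp : 1 ≤ p)
    (hg : DifferentiableOn ℂ g (ball w s)) :
    ENNReal.ofReal (‖g w‖ ^ p) * ENNReal.ofReal (2 * π) ≤
      ∫⁻ θ in Set.Ioo (-π) π, ENNReal.ofReal (‖g (circleMap w t θ)‖ ^ p) := by
  have hmem : ∀ θ, circleMap w t θ ∈ ball w s := fun θ => by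
    simp [circleMap, abs_of_pos ht, hts, mem_ball, dist_eq_norm]
  have hcont : Continuous (fun θ => g (circleMap w t θ)) :=
    hg.continuousOn.comp_continuous (continuous_circleMap w t) hmem
  have hcp : Continuous (fun θ => ‖g (circleMap w t θ)‖ ^ p) :=
    hcont.norm.rpow_const (fun _ => Or.inr (by linarith))
  have h1 : DiffContOnCl ℂ g (ball w |t|) := by
    rw [abs_of_pos ht]
    exact hg.diffContOnCl_ball (closedBall_subset_ball hts)
  have h2 := h1.circleAverage
  have hπ := Real.pi_pos
  have hper : Function.Periodic (fun θ => g (circleMap w t θ)) (2 * π) := fun θ => by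
    simp [periodic_circleMap w t θ]
  have h3 : ∫ θ in (0:ℝ)..2*π, g (circleMap w t θ) = ∫ θ in (-π)..π, g (circleMap w t θ) := by
    have := hper.intervalIntegral_add_eq 0 (-π)
    rw [zero_add] at this
    rw [this]; congr 1; ring
  have hvol : volume.real (Set.Ioo (-π) π) = 2 * π := by
    rw [Real.volume_real_Ioo_of_le (by linarith)]; ring
  have h4 : ‖g w‖ ≤ ⨍ θ in Set.Ioo (-π) π, ‖g (circleMap w t θ)‖ := by
    rw [← h2, Real.circleAverage_def, h3, setAverage_eq, hvol, norm_smul,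
      intervalIntegral.integral_of_le (by linarith), integral_Ioc_eq_integral_Ioo]
    rw [Real.norm_of_nonneg (by positivity), smul_eq_mul]
    gcongr
    exact norm_integral_le_integral_norm _
  have i1 : IntegrableOn (fun θ => ‖g (circleMap w t θ)‖) (Set.Ioo (-π) π) :=
    (hcont.norm.continuousOn.integrableOn_Icc).mono_set Set.Ioo_subset_Icc_self
  have i2 : IntegrableOn (fun θ => ‖g (circleMap w t θ)‖ ^ p) (Set.Ioo (-π) π) :=
    (hcp.continuousOn.integrableOn_Icc).mono_set Set.Ioo_subset_Icc_self
  have h5 := (convexOn_rpow hp).map_set_average_le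
    (continuousOn_id.rpow_const (fun _ _ => Or.inr (by linarith))) isClosed_Ici
    (t := Set.Ioo (-π) π) (μ := volume) (f := fun θ => ‖g (circleMap w t θ)‖)
    (by simp; linarith) (by simp) (by filter_upwards with θ; simp) i1 i2
  have h6 : ‖g w‖ ^ p ≤ ⨍ θ in Set.Ioo (-π) π, ‖g (circleMap w t θ)‖ ^ p :=
    (Real.rpow_le_rpow (norm_nonneg _) h4 (by linarith)).trans h5
  rw [setAverage_eq, hvol, smul_eq_mul] at h6
  rw [← ofReal_integral_eq_lintegral_ofReal i2 (by filter_upwards with θ; positivity),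
    ← ENNReal.ofReal_mul (by positivity)]
  apply ENNReal.ofReal_le_ofReal
  calc _ ≤ ((2 * π)⁻¹ * ∫ θ in Set.Ioo (-π) π, ‖g (circleMap w t θ)‖ ^ p) * (2 * π) := by gcongr
    _ = _ := by field_simp

lemma ball_submean {g : ℂ → ℂ} {w : ℂ} {s : ℝ} (hs : 0 < s) {p : ℝ} (hp : 1 ≤ p)
    (hg : DifferentiableOn ℂ g (ball w s)) :
    ENNReal.ofReal (‖g w‖ ^ p) * ENNReal.ofReal (s ^ 2) ≤
      ∫⁻ z in ball w s, ENNReal.ofReal (‖g z‖ ^ p) := by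
  set φ : ℂ → ℝ := fun z => ‖g z‖ ^ p with hφ
  have hφc : ContinuousOn φ (ball w s) :=
    hg.continuousOn.norm.rpow_const (fun _ _ => Or.inr (by linarith))
  set G := (ball w s).indicator (fun z => ENNReal.ofReal (φ z)) with hGd
  have hG : Measurable G := meas_ind isOpen_ball hφc
  have hGt : Measurable (fun z => G (w + z)) := hG.comp (measurable_const_add w)
  have e1 : ∫⁻ z in ball w s, ENNReal.ofReal (‖g z‖ ^ p) = ∫⁻ z, G (w + z) := by
    rw [lintegral_add_left_eq_self (fun z => G z) w, hGd, lintegral_indicator measurableSet_ball]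
  rw [e1]
  refine le_trans ?_ (setLIntegral_le_lintegral {z : ℂ | s/2 < ‖z‖ ∧ ‖z‖ < s} _)
  rw [polar_annulus hGt (by positivity)]
  have hcm : Measurable (fun q : ℝ × ℝ => circleMap 0 q.2 q.1) := by
    unfold circleMap; fun_prop
  have hm : Measurable (fun q : ℝ × ℝ => ENNReal.ofReal q.2 * G (w + circleMap 0 q.2 q.1)) :=
    (by fun_prop : Measurable (fun q : ℝ × ℝ => ENNReal.ofReal q.2)).mul (hGt.comp hcm)
  rw [lintegral_lintegral_swap hm.aemeasurable]
  calc ENNReal.ofReal (φ w) * ENNReal.ofReal (s ^ 2)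
      ≤ ENNReal.ofReal (s / 2) * (ENNReal.ofReal (φ w) * ENNReal.ofReal (2 * π))
          * volume (Set.Ioo (s/2) s) := by
        rw [Real.volume_Ioo]
        have h0 : 0 ≤ φ w := by positivity
        have := Real.pi_gt_three
        rw [← ENNReal.ofReal_mul h0, ← ENNReal.ofReal_mul h0, ← ENNReal.ofReal_mul (by positivity),
          ← ENNReal.ofReal_mul (by positivity)]
        apply ENNReal.ofReal_le_ofReal
        have h2 : s / 2 * (φ w * (2 * π)) * (s - s / 2) = φ w * (s^2 * (π/2)) := by ring
        rw [h2]
        gcongr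
        nlinarith [sq_nonneg s]
    _ = ∫⁻ r in Set.Ioo (s/2) s,
          ENNReal.ofReal (s / 2) * (ENNReal.ofReal (φ w) * ENNReal.ofReal (2 * π)) := by
        rw [setLIntegral_const]
    _ ≤ _ := by
        apply setLIntegral_mono' measurableSet_Ioo
        intro r hr
        have hr0 : 0 < r := by have := hr.1; linarith
        rw [lintegral_const_mul']
        swap; · exact ENNReal.ofReal_ne_top
        gcongr
        · exact hr.1.le
        · refine (circle_submean hr0 hr.2 hp hg).trans (le_of_eq ?_)
          congr 1
          ext θ
          have e : w + circleMap 0 r θ = circleMap w r θ := by simp [circleMap]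
          rw [e, hGd, Set.indicator_of_mem]
          simp [circleMap, abs_of_pos hr0, hr.2, mem_ball, dist_eq_norm]

lemma deriv_submean {g : ℂ → ℂ} {z : ℂ} {R : ℝ} (hR : 0 < R) {p : ℝ} (hp : 1 ≤ p)
    (hg : DifferentiableOn ℂ g (ball z (2 * R))) :
    ENNReal.ofReal (‖deriv g z‖ ^ p * R ^ p) * ENNReal.ofReal (R ^ 2) ≤
      ∫⁻ w in ball z (2 * R), ENNReal.ofReal (‖g w‖ ^ p) := by
  have hcl : closedBall z R ⊆ ball z (2 * R) := closedBall_subset_ball (by linarith)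
  have hd : DiffContOnCl ℂ g (ball z R) := hg.diffContOnCl_ball hcl
  obtain ⟨w, hw, hmax⟩ := (isCompact_sphere z R).exists_isMaxOn
    (NormedSpace.sphere_nonempty.2 hR.le)
    ((hg.continuousOn.mono (sphere_subset_closedBall.trans hcl)).norm)
  have h1 := Complex.norm_deriv_le_of_forall_mem_sphere_norm_le hR hd (fun x hx => hmax hx)
  have hsub : ball w R ⊆ ball z (2 * R) := by
    apply ball_subset_ball'
    rw [mem_sphere.1 hw]; linarith
  refine le_trans ?_ ((ball_submean hR hp (hg.mono hsub)).trans (lintegral_mono_set hsub))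
  gcongr
  rw [← Real.mul_rpow (norm_nonneg _) hR.le]
  apply Real.rpow_le_rpow (by positivity) _ (by linarith)
  rwa [← le_div_iff₀ hR]

lemma tonelli_bound {G : ℂ → ENNReal} (hG : Measurable G) {α : ℝ} (hα : 0 ≤ α) :
    ∫⁻ z in ball (0:ℂ) 1, ENNReal.ofReal ((1 - ‖z‖) ^ α / (1 - ‖z‖) ^ 2) *
        ∫⁻ w in ball z ((1 - ‖z‖) / 2), G w ≤
      ENNReal.ofReal (2 ^ α * 4 * π) *
        ∫⁻ w in ball (0:ℂ) 1, ENNReal.ofReal ((1 - ‖w‖) ^ α) * G w := by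
  classical
  set K : ℂ → ℂ → ENNReal := fun z w => if dist w z < (1 - ‖z‖) / 2 then
    ENNReal.ofReal ((1 - ‖z‖) ^ α / (1 - ‖z‖) ^ 2) else 0 with hK
  have hKm : Measurable (Function.uncurry K) := by
    refine Measurable.ite (measurableSet_lt ?_ ?_) ?_ measurable_const
    · exact measurable_snd.dist measurable_fst
    · fun_prop
    · fun_prop
  have hm : Measurable (Function.uncurry (fun z w => K z w * G w)) :=
    hKm.mul (hG.comp measurable_snd)
  have step1 : ∫⁻ z in ball (0:ℂ) 1, ENNReal.ofReal ((1 - ‖z‖) ^ α / (1 - ‖z‖) ^ 2) *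
        ∫⁻ w in ball z ((1 - ‖z‖) / 2), G w ≤
        ∫⁻ z in ball (0:ℂ) 1, ∫⁻ w in ball (0:ℂ) 1, K z w * G w := by
    apply setLIntegral_mono' measurableSet_ball
    intro z hz
    have hz' : ‖z‖ < 1 := by simpa using hz
    rw [← lintegral_const_mul' _ _ ENNReal.ofReal_ne_top]
    have hsub : ball z ((1 - ‖z‖) / 2) ⊆ ball (0:ℂ) 1 := by
      apply ball_subset_ball'
      rw [dist_zero_right]; linarith
    refine le_trans (le_of_eq ?_) (lintegral_mono_set hsub)
    apply setLIntegral_congr_fun measurableSet_ball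
    intro w hw
    have : dist w z < (1 - ‖z‖) / 2 := hw
    simp only [hK, if_pos this]
  refine step1.trans ?_
  rw [lintegral_lintegral_swap hm.aemeasurable, ← lintegral_const_mul' _ _ ENNReal.ofReal_ne_top]
  apply setLIntegral_mono' measurableSet_ball
  intro w hw
  have hw' : ‖w‖ < 1 := by simpa using hw
  have hδ : 0 < 1 - ‖w‖ := by linarith
  have hKw : Measurable (fun z => K z w) := hKm.comp (measurable_id.prodMk measurable_const)
  rw [lintegral_mul_const _ hKw, ← mul_assoc]
  gcongr
  calc ∫⁻ z in ball (0:ℂ) 1, K z w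
      ≤ ∫⁻ z in ball (0:ℂ) 1, (ball w (1 - ‖w‖)).indicator
          (fun _ => ENNReal.ofReal (2 ^ α * (1 - ‖w‖) ^ α * (4 / (1 - ‖w‖) ^ 2))) z := by
        apply setLIntegral_mono' measurableSet_ball
        intro z hz
        have hz' : ‖z‖ < 1 := by simpa using hz
        have hδz : 0 < 1 - ‖z‖ := by linarith
        simp only [hK]
        split_ifs with h
        · have h1 : ‖w‖ ≤ ‖z‖ + dist w z := by
            rw [dist_eq_norm]; simpa using norm_add_le z (w - z)
          have h2 : ‖z‖ ≤ ‖w‖ + dist w z := by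
            rw [dist_comm, dist_eq_norm]; simpa using norm_add_le w (z - w)
          rw [Set.indicator_of_mem (by rw [mem_ball, dist_comm]; linarith)]
          apply ENNReal.ofReal_le_ofReal
          rw [← Real.mul_rpow (by norm_num) hδ.le, div_eq_mul_one_div]
          have h3 : 1 / (1 - ‖z‖) ^ 2 ≤ 4 / (1 - ‖w‖) ^ 2 := by
            rw [div_le_div_iff₀ (by positivity) (by positivity)]
            nlinarith
          have h4 : 1 - ‖z‖ ≤ 2 * (1 - ‖w‖) := by linarith
          exact mul_le_mul (Real.rpow_le_rpow hδz.le h4 hα) h3 (by positivity) (by positivity)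
        · exact zero_le
    _ ≤ ∫⁻ z, (ball w (1 - ‖w‖)).indicator
          (fun _ => ENNReal.ofReal (2 ^ α * (1 - ‖w‖) ^ α * (4 / (1 - ‖w‖) ^ 2))) z :=
        setLIntegral_le_lintegral _ _
    _ = ENNReal.ofReal (2 ^ α * 4 * π) * ENNReal.ofReal ((1 - ‖w‖) ^ α) := by
        rw [lintegral_indicator measurableSet_ball, setLIntegral_const, Complex.volume_ball,
          ← ENNReal.ofReal_pow hδ.le]
        have : (NNReal.pi : ENNReal) = ENNReal.ofReal π := by
          rw [ENNReal.ofReal, Real.toNNReal_of_nonneg Real.pi_pos.le]; rfl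
        rw [this, ← ENNReal.ofReal_mul (by positivity), ← ENNReal.ofReal_mul (by positivity),
          ← ENNReal.ofReal_mul (by positivity)]
        congr 1
        field_simp

lemma young_aux {p F b : ℝ} (hp : 1 ≤ p) (hF : 0 < F) (hb : 0 ≤ b) :
    p * F ^ (p - 1) * b ≤ F ^ p / 2 + p * (2 * p) ^ (p - 1) * b ^ p := by
  have hFp : F ^ p = F ^ (p - 1) * F := by
    rw [← Real.rpow_add_one hF.ne']; congr 1; ring
  by_cases h : b ≤ F / (2 * p)
  · have h1 : p * F ^ (p - 1) * b ≤ p * F ^ (p - 1) * (F / (2 * p)) := by gcongr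
    have h2 : p * F ^ (p - 1) * (F / (2 * p)) = F ^ p / 2 := by rw [hFp]; field_simp
    have h3 : 0 ≤ p * (2 * p) ^ (p - 1) * b ^ p := by positivity
    linarith
  · push Not at h
    have hb0 : 0 < b := lt_of_le_of_lt (by positivity) h
    have h1 : F ≤ 2 * p * b := by
      rw [div_lt_iff₀ (by positivity)] at h; linarith
    have hbp : b ^ p = b ^ (p - 1) * b := by
      rw [← Real.rpow_add_one hb0.ne']; congr 1; ring
    have h2 : F ^ (p - 1) ≤ (2 * p) ^ (p - 1) * b ^ (p - 1) := by
      rw [← Real.mul_rpow (by positivity) hb]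
      exact Real.rpow_le_rpow hF.le h1 (by linarith)
    have h3 : p * F ^ (p - 1) * b ≤ p * ((2 * p) ^ (p - 1) * b ^ (p - 1)) * b := by gcongr
    have h4 : 0 ≤ F ^ p / 2 := by positivity
    rw [hbp]
    nlinarith

lemma hardy_R {α p : ℝ} (hα : 0 ≤ α) (hp : 1 ≤ p) {F h : ℝ → ℝ} {a R : ℝ} (ha : 0 ≤ a)
    (haR : a ≤ R) (hR : R < 1)
    (hF : ∀ r ∈ Set.Icc a R, 0 < F r) (hh : ∀ r ∈ Set.Icc a R, 0 ≤ h r)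
    (hd : ∀ r ∈ Set.Icc a R, HasDerivAt F (h r) r) (hc : ContinuousOn h (Set.Icc a R)) :
    ∫ r in a..R, (1 - r) ^ α * F r ^ p ≤
      2 * F a ^ p + 2 * (p * (2 * p) ^ (p - 1)) * ∫ r in a..R, (1 - r) ^ (α + p) * h r ^ p := by
  set C := p * (2 * p) ^ (p - 1) with hC
  have hpos : ∀ r ∈ Set.Icc a R, 0 < 1 - r := fun r hr => by linarith [hr.2]
  have hu : Set.uIcc a R = Set.Icc a R := Set.uIcc_of_le haR
  have hFc : ContinuousOn F (Set.Icc a R) :=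
    fun r hr => (hd r hr).continuousAt.continuousWithinAt
  have hx : ∀ β : ℝ, ContinuousOn (fun r : ℝ => (1 - r) ^ β) (Set.Icc a R) := fun β =>
    ContinuousOn.rpow_const (by fun_prop) (fun r hr => Or.inl (hpos r hr).ne')
  have hFq : ∀ q : ℝ, ContinuousOn (fun r : ℝ => F r ^ q) (Set.Icc a R) := fun β =>
    ContinuousOn.rpow_const hFc (fun r hr => Or.inl (hF r hr).ne')
  have hhp : ContinuousOn (fun r : ℝ => h r ^ p) (Set.Icc a R) :=
    ContinuousOn.rpow_const hc (fun r hr => Or.inr (by linarith))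
  have cA : ContinuousOn (fun r => (1 - r) ^ α * F r ^ p) (Set.Icc a R) := (hx _).mul (hFq _)
  have cB : ContinuousOn (fun r => (1 - r) ^ (α + p) * h r ^ p) (Set.Icc a R) := (hx _).mul hhp
  have cD : ContinuousOn (fun r => (-1) * (α + 1) * (1 - r) ^ (α + 1 - 1) * F r ^ p +
      (1 - r) ^ (α + 1) * (h r * p * F r ^ (p - 1))) (Set.Icc a R) :=
    ((continuousOn_const.mul (hx _)).mul (hFq _)).add
      ((hx _).mul ((hc.mul continuousOn_const).mul (hFq _)))
  have hΦ : ∀ r ∈ Set.uIcc a R, HasDerivAt (fun r => (1 - r) ^ (α + 1) * F r ^ p)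
      ((-1) * (α + 1) * (1 - r) ^ (α + 1 - 1) * F r ^ p +
      (1 - r) ^ (α + 1) * (h r * p * F r ^ (p - 1))) r := by
    intro r hr
    rw [hu] at hr
    exact (((hasDerivAt_id r).const_sub 1).rpow_const (Or.inl (hpos r hr).ne')).mul
      ((hd r hr).rpow_const (Or.inl (hF r hr).ne'))
  have iA : IntervalIntegrable (fun r => (1 - r) ^ α * F r ^ p) volume a R :=
    ContinuousOn.intervalIntegrable (by rwa [hu])
  have iB : IntervalIntegrable (fun r => (1 - r) ^ (α + p) * h r ^ p) volume a R :=
    ContinuousOn.intervalIntegrable (by rwa [hu])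
  have iD := ContinuousOn.intervalIntegrable (μ := volume) (by rwa [← hu] at cD)
  have hFTC := intervalIntegral.integral_eq_sub_of_hasDerivAt hΦ iD
  have hmono := intervalIntegral.integral_mono_on (μ := volume) haR
    (iA.const_mul (1/2)) ((iD.neg).add (iB.const_mul C)) (fun r hr => by
      have h1 := hpos r hr
      have hy := young_aux hp (hF r hr) (mul_nonneg h1.le (hh r hr))
      rw [Real.mul_rpow h1.le (hh r hr)] at hy
      have e1 : α + 1 - 1 = α := by ring
      have e2 : (1 - r) ^ (α + 1) = (1 - r) ^ α * (1 - r) := Real.rpow_add_one h1.ne' _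
      have e3 : (1 - r) ^ (α + p) = (1 - r) ^ α * (1 - r) ^ p := Real.rpow_add h1 _ _
      simp only [Pi.neg_apply, e1, e2, e3]
      have h2 : 0 ≤ (1 - r) ^ α := by positivity
      have h3 := mul_le_mul_of_nonneg_left hy h2
      have h4 : 0 ≤ α * ((1 - r) ^ α * F r ^ p) :=
        mul_nonneg hα (mul_nonneg h2 (Real.rpow_nonneg (hF r hr).le _))
      rw [hC]
      nlinarith)
  rw [intervalIntegral.integral_const_mul, intervalIntegral.integral_add iD.neg (iB.const_mul C),
    intervalIntegral.integral_const_mul] at hmono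
  have hneg : ∫ r in a..R, (-fun r => (-1) * (α + 1) * (1 - r) ^ (α + 1 - 1) * F r ^ p +
      (1 - r) ^ (α + 1) * (h r * p * F r ^ (p - 1))) r =
      -((1 - R) ^ (α + 1) * F R ^ p - (1 - a) ^ (α + 1) * F a ^ p) := by
    rw [← hFTC, ← intervalIntegral.integral_neg]; rfl
  rw [hneg] at hmono
  have h5 : 0 ≤ (1 - R) ^ (α + 1) * F R ^ p :=
    mul_nonneg (Real.rpow_nonneg (by linarith) _)
      (Real.rpow_nonneg (hF R (Set.right_mem_Icc.2 haR)).le _)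
  have h6 : (1 - a) ^ (α + 1) * F a ^ p ≤ F a ^ p := by
    apply mul_le_of_le_one_left (Real.rpow_nonneg (hF a (Set.left_mem_Icc.2 haR)).le _)
    exact Real.rpow_le_one (by linarith) (by linarith) (by linarith)
  linarith

lemma hardy {α p : ℝ} (hα : 0 ≤ α) (hp : 1 ≤ p) {F h : ℝ → ℝ} {a : ℝ} (ha : 0 ≤ a) (ha1 : a < 1)
    (hF : ∀ r ∈ Set.Ico a 1, 0 < F r) (hh : ∀ r ∈ Set.Ico a 1, 0 ≤ h r)
    (hd : ∀ r ∈ Set.Ico a 1, HasDerivAt F (h r) r) (hc : ContinuousOn h (Set.Ico a 1)) :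
    ∫⁻ r in Set.Ioo a 1, ENNReal.ofReal ((1 - r) ^ α * F r ^ p) ≤
      ENNReal.ofReal (2 * F a ^ p) + ENNReal.ofReal (2 * (p * (2 * p) ^ (p - 1))) *
        ∫⁻ r in Set.Ioo a 1, ENNReal.ofReal ((1 - r) ^ (α + p) * h r ^ p) := by
  have hU' : Set.Ioo a 1 = ⋃ n : ℕ, Set.Ioc a (1 - (1 - a) / (n + 1)) := by
    ext r
    simp only [Set.mem_iUnion, Set.mem_Ioo, Set.mem_Ioc]
    constructor
    · rintro ⟨h1, h2⟩
      obtain ⟨n, hn⟩ := exists_nat_gt ((1 - a) / (1 - r))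
      refine ⟨n, h1, ?_⟩
      rw [div_lt_iff₀ (by linarith)] at hn
      have : (1 - a) / (n + 1) ≤ 1 - r := by
        rw [div_le_iff₀ (by positivity)]; nlinarith
      linarith
    · rintro ⟨n, h1, h2⟩
      have : 0 < (1 - a) / (n + 1) := div_pos (by linarith) (by positivity)
      exact ⟨h1, by linarith⟩
  have hdir : Directed (· ⊆ ·) (fun n : ℕ => Set.Ioc a (1 - (1 - a) / ((n:ℝ) + 1))) := by
    apply Monotone.directed_le
    intro m n hmn
    apply Set.Ioc_subset_Ioc_right
    have : (m:ℝ) ≤ n := by exact_mod_cast hmn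
    have : 0 < 1 - a := by linarith
    gcongr
  conv_lhs => rw [hU', setLIntegral_iUnion_of_directed _ hdir]
  apply iSup_le
  intro n
  set R := 1 - (1 - a) / ((n:ℝ) + 1) with hRd
  have hR : R < 1 := by
    have : 0 < (1 - a) / ((n:ℝ) + 1) := div_pos (by linarith) (by positivity)
    linarith
  have haR : a ≤ R := by
    have : (1 - a) / ((n:ℝ) + 1) ≤ 1 - a := div_le_self (by linarith) (by linarith [n.cast_nonneg (α := ℝ)])
    linarith
  have hss : Set.Icc a R ⊆ Set.Ico a 1 := fun r hr => ⟨hr.1, hr.2.trans_lt hR⟩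
  have key := hardy_R hα hp ha haR hR (fun r hr => hF r (hss hr)) (fun r hr => hh r (hss hr))
    (fun r hr => hd r (hss hr)) (hc.mono hss)
  have hFc : ContinuousOn F (Set.Icc a R) :=
    fun r hr => (hd r (hss hr)).continuousAt.continuousWithinAt
  have hx : ∀ β : ℝ, ContinuousOn (fun r : ℝ => (1 - r) ^ β) (Set.Icc a R) := fun β =>
    ContinuousOn.rpow_const (by fun_prop) (fun r hr => Or.inl (by linarith [hr.2] : 0 < 1 - r).ne')
  have iA : IntegrableOn (fun r => (1 - r) ^ α * F r ^ p) (Set.Ioc a R) :=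
    (((hx _).mul (hFc.rpow_const (fun r hr => Or.inr (by linarith)))).integrableOn_Icc).mono_set
      Set.Ioc_subset_Icc_self
  have iB : IntegrableOn (fun r => (1 - r) ^ (α + p) * h r ^ p) (Set.Ioc a R) :=
    (((hx _).mul ((hc.mono hss).rpow_const
      (fun r hr => Or.inr (by linarith)))).integrableOn_Icc).mono_set
      Set.Ioc_subset_Icc_self
  have nA : 0 ≤ᵐ[volume.restrict (Set.Ioc a R)] (fun r => (1 - r) ^ α * F r ^ p) := by
    filter_upwards [ae_restrict_mem measurableSet_Ioc] with r hr
    have := hF r ⟨hr.1.le, hr.2.trans_lt hR⟩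
    have : 0 < 1 - r := by linarith [hr.2]
    simp only [Pi.zero_apply]; positivity
  have nB : 0 ≤ᵐ[volume.restrict (Set.Ioc a R)] (fun r => (1 - r) ^ (α + p) * h r ^ p) := by
    filter_upwards [ae_restrict_mem measurableSet_Ioc] with r hr
    have := hh r ⟨hr.1.le, hr.2.trans_lt hR⟩
    have : 0 < 1 - r := by linarith [hr.2]
    simp only [Pi.zero_apply]; positivity
  rw [intervalIntegral.integral_of_le haR, intervalIntegral.integral_of_le haR] at key
  rw [← ofReal_integral_eq_lintegral_ofReal iA nA]
  have hFa : 0 < F a := hF a ⟨le_rfl, ha1⟩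
  calc _ ≤ _ := ENNReal.ofReal_le_ofReal key
    _ ≤ _ := ENNReal.ofReal_add_le
    _ ≤ _ := by
      rw [ENNReal.ofReal_mul (by positivity : 0 ≤ 2 * (p * (2 * p) ^ (p - 1))),
        ofReal_integral_eq_lintegral_ofReal iB nB]
      gcongr

lemma fwd {α p : ℝ} (hα : 0 ≤ α) (hp : 1 ≤ p) {g : ℂ → ℂ}
    (hg : DifferentiableOn ℂ g (ball (0:ℂ) 1))
    (h : ∫⁻ z in ball (0:ℂ) 1, ENNReal.ofReal ((1 - ‖z‖) ^ α * ‖g z‖ ^ p) < ⊤) :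
    ∫⁻ z in ball (0:ℂ) 1, ENNReal.ofReal ((1 - ‖z‖) ^ (α + p) * ‖deriv g z‖ ^ p) < ⊤ := by
  have hc : ContinuousOn (fun z => ‖g z‖ ^ p) (ball (0:ℂ) 1) :=
    hg.continuousOn.norm.rpow_const (fun _ _ => Or.inr (by linarith))
  set G := (ball (0:ℂ) 1).indicator (fun z => ENNReal.ofReal (‖g z‖ ^ p)) with hGd
  have hG : Measurable G := meas_ind isOpen_ball hc
  have h1 : ∫⁻ z in ball (0:ℂ) 1, ENNReal.ofReal ((1 - ‖z‖) ^ (α + p) * ‖deriv g z‖ ^ p) ≤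
      ∫⁻ z in ball (0:ℂ) 1, ENNReal.ofReal (4 ^ p * 16) *
        (ENNReal.ofReal ((1 - ‖z‖) ^ α / (1 - ‖z‖) ^ 2) *
        ∫⁻ w in ball z ((1 - ‖z‖) / 2), G w) := by
    apply setLIntegral_mono' measurableSet_ball
    intro z hz
    have hz' : ‖z‖ < 1 := by simpa using hz
    have hδ : 0 < 1 - ‖z‖ := by linarith
    have hR : 0 < (1 - ‖z‖) / 4 := by positivity
    have e2 : 2 * ((1 - ‖z‖) / 4) = (1 - ‖z‖) / 2 := by ring
    have hsub : ball z ((1 - ‖z‖) / 2) ⊆ ball (0:ℂ) 1 := by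
      apply ball_subset_ball'
      rw [dist_zero_right]; linarith
    have key := deriv_submean hR hp (hg.mono (by rwa [e2]))
    rw [e2] at key
    have e3 : ∫⁻ w in ball z ((1 - ‖z‖) / 2), G w =
        ∫⁻ w in ball z ((1 - ‖z‖) / 2), ENNReal.ofReal (‖g w‖ ^ p) := by
      apply setLIntegral_congr_fun measurableSet_ball
      intro w hw
      exact Set.indicator_of_mem (hsub hw) _
    rw [e3]
    calc ENNReal.ofReal ((1 - ‖z‖) ^ (α + p) * ‖deriv g z‖ ^ p)
        = ENNReal.ofReal (4 ^ p * 16) * (ENNReal.ofReal ((1 - ‖z‖) ^ α / (1 - ‖z‖) ^ 2) *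
          (ENNReal.ofReal (‖deriv g z‖ ^ p * ((1 - ‖z‖) / 4) ^ p) *
            ENNReal.ofReal (((1 - ‖z‖) / 4) ^ 2))) := by
          rw [← ENNReal.ofReal_mul (by positivity), ← ENNReal.ofReal_mul (by positivity),
            ← ENNReal.ofReal_mul (by positivity)]
          congr 1
          rw [Real.div_rpow hδ.le (by norm_num), Real.rpow_add hδ]
          field_simp
          norm_num
      _ ≤ _ := by gcongr
  refine h1.trans_lt ?_
  rw [lintegral_const_mul' _ _ ENNReal.ofReal_ne_top]
  refine ENNReal.mul_lt_top ENNReal.ofReal_lt_top ((tonelli_bound hG hα).trans_lt ?_)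
  refine ENNReal.mul_lt_top ENNReal.ofReal_lt_top (lt_of_eq_of_lt ?_ h)
  apply setLIntegral_congr_fun measurableSet_ball
  intro w hw
  have hw' : ‖w‖ < 1 := by simpa using hw
  simp only [hGd, Set.indicator_of_mem hw]
  rw [← ENNReal.ofReal_mul (Real.rpow_nonneg (by linarith) _)]

lemma radial {α p : ℝ} (hα : 0 ≤ α) (hp : 1 ≤ p) {g : ℂ → ℂ}
    (hg : DifferentiableOn ℂ g (ball (0:ℂ) 1)) {M : ℝ}
    (hM : ∀ z ∈ closedBall (0:ℂ) (1/2), ‖g z‖ ≤ M) (θ : ℝ) :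
    ∫⁻ r in Set.Ioo (1/2:ℝ) 1, ENNReal.ofReal ((1 - r) ^ α * ‖g (circleMap 0 r θ)‖ ^ p) ≤
      ENNReal.ofReal (2 * (M + 1) ^ p) + ENNReal.ofReal (2 * (p * (2 * p) ^ (p - 1))) *
        ∫⁻ r in Set.Ioo (1/2:ℝ) 1,
          ENNReal.ofReal ((1 - r) ^ (α + p) * ‖deriv g (circleMap 0 r θ)‖ ^ p) := by
  have hM0 : 0 ≤ M := (norm_nonneg _).trans (hM 0 (by simp))
  have hmem : ∀ r ∈ Set.Ioo (-1:ℝ) 1, circleMap 0 r θ ∈ ball (0:ℂ) 1 := fun r hr => by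
    simp [abs_lt, hr.1, hr.2]
  have hcm : ∀ r : ℝ, HasDerivAt (fun r : ℝ => circleMap 0 r θ) (Complex.exp (θ * Complex.I)) r := by
    intro r
    have := ((Complex.ofRealCLM.hasDerivAt (x := r)).mul_const
      (Complex.exp (θ * Complex.I))).const_add 0
    simpa [circleMap] using this
  have hcmc : Continuous (fun r : ℝ => circleMap 0 r θ) :=
    continuous_iff_continuousAt.2 fun r => (hcm r).continuousAt
  set h : ℝ → ℝ := fun r => ‖deriv g (circleMap 0 r θ)‖ with hh
  have hc : ContinuousOn h (Set.Ioo (-1:ℝ) 1) :=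
    ((hg.deriv isOpen_ball).continuousOn.comp hcmc.continuousOn hmem).norm
  set F : ℝ → ℝ := fun r => (M + 1) + ∫ t in (1/2:ℝ)..r, h t with hF
  have hsub : Set.Ico (1/2:ℝ) 1 ⊆ Set.Ioo (-1:ℝ) 1 := fun r hr => ⟨by linarith [hr.1], hr.2⟩
  have hFd : ∀ r ∈ Set.Ico (1/2:ℝ) 1, HasDerivAt F (h r) r := by
    intro r hr
    apply HasDerivAt.const_add
    apply intervalIntegral.integral_hasDerivAt_right
    · apply ContinuousOn.intervalIntegrable
      rw [Set.uIcc_of_le hr.1]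
      exact hc.mono (fun x hx => hsub ⟨hx.1, hx.2.trans_lt hr.2⟩)
    · exact hc.stronglyMeasurableAtFilter isOpen_Ioo r (hsub hr)
    · exact hc.continuousAt (isOpen_Ioo.mem_nhds (hsub hr))
  have hFpos : ∀ r ∈ Set.Ico (1/2:ℝ) 1, 0 < F r := by
    intro r hr
    have : 0 ≤ ∫ t in (1/2:ℝ)..r, h t :=
      intervalIntegral.integral_nonneg hr.1 (fun _ _ => norm_nonneg _)
    simp only [hF]; linarith
  have hF2 : F (1/2) = M + 1 := by simp [hF]
  have hgF : ∀ r ∈ Set.Ico (1/2:ℝ) 1, ‖g (circleMap 0 r θ)‖ ≤ F r := by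
    intro r hr
    have hs : Set.Icc (1/2:ℝ) r ⊆ Set.Ico (1/2:ℝ) 1 := fun x hx => ⟨hx.1, hx.2.trans_lt hr.2⟩
    have hgd : ∀ x ∈ Set.Ico (1/2:ℝ) 1, HasDerivAt (fun r : ℝ => g (circleMap 0 r θ))
        (deriv g (circleMap 0 x θ) * Complex.exp (θ * Complex.I)) x := by
      intro x hx
      have := (hg.differentiableAt (isOpen_ball.mem_nhds (hmem x (hsub hx)))).hasDerivAt
      exact HasDerivAt.comp x this (hcm x)
    have := image_norm_le_of_norm_deriv_right_le_deriv_boundary' (a := 1/2) (b := r)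
      (f := fun r : ℝ => g (circleMap 0 r θ)) (B := F) (B' := h)
      (f' := fun x => deriv g (circleMap 0 x θ) * Complex.exp (θ * Complex.I))
      (fun x hx => (hgd x (hs hx)).continuousAt.continuousWithinAt)
      (fun x hx => (hgd x (hs ⟨hx.1, hx.2.le⟩)).hasDerivWithinAt)
      (by
        rw [hF2]
        have := hM (circleMap 0 (1/2) θ) (by simp [abs_of_pos])
        linarith)
      (fun x hx => (hFd x (hs hx)).continuousAt.continuousWithinAt)
      (fun x hx => (hFd x (hs ⟨hx.1, hx.2.le⟩)).hasDerivWithinAt)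
      (fun x hx => by simp [hh])
    exact this ⟨hr.1, le_rfl⟩
  have key := hardy hα hp (by norm_num) (by norm_num) hFpos (fun r _ => norm_nonneg _) hFd
    (hc.mono hsub)
  rw [hF2] at key
  refine le_trans ?_ key
  apply setLIntegral_mono' measurableSet_Ioo
  intro r hr
  have : 0 < 1 - r := by linarith [hr.2]
  have := hgF r ⟨hr.1.le, hr.2⟩
  gcongr

lemma bwd {α p : ℝ} (hα : 0 ≤ α) (hp : 1 ≤ p) {g : ℂ → ℂ}
    (hg : DifferentiableOn ℂ g (ball (0:ℂ) 1))
    (h : ∫⁻ z in ball (0:ℂ) 1, ENNReal.ofReal ((1 - ‖z‖) ^ (α + p) * ‖deriv g z‖ ^ p) < ⊤) :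
    ∫⁻ z in ball (0:ℂ) 1, ENNReal.ofReal ((1 - ‖z‖) ^ α * ‖g z‖ ^ p) < ⊤ := by
  obtain ⟨M, hM⟩ := (isCompact_closedBall (0:ℂ) (1/2)).exists_bound_of_continuousOn
    (hg.continuousOn.mono (closedBall_subset_ball (by norm_num)))
  have hM0 : 0 ≤ M := (norm_nonneg _).trans (hM 0 (by simp))
  set A := {z : ℂ | 1/2 < ‖z‖ ∧ ‖z‖ < 1} with hA
  have hAm : MeasurableSet A :=
    (measurableSet_lt measurable_const measurable_norm).inter
      (measurableSet_lt measurable_norm measurable_const)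
  have hAB : A ⊆ ball (0:ℂ) 1 := fun z hz => by simpa using hz.2
  have hcov : ball (0:ℂ) 1 ⊆ closedBall (0:ℂ) (1/2) ∪ A := by
    intro z hz
    have hz' : ‖z‖ < 1 := by simpa using hz
    by_cases h' : ‖z‖ ≤ 1/2
    · left; simpa using h'
    · right; exact ⟨not_le.1 h', hz'⟩
  have hcx : ∀ {β : ℝ}, 0 ≤ β → ∀ {u : ℂ → ℂ}, DifferentiableOn ℂ u (ball (0:ℂ) 1) →
      ContinuousOn (fun z => (1 - ‖z‖) ^ β * ‖u z‖ ^ p) (ball (0:ℂ) 1) := fun hβ u hu =>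
    (ContinuousOn.rpow_const (by fun_prop) (fun _ _ => Or.inr hβ)).mul
      (hu.continuousOn.norm.rpow_const (fun _ _ => Or.inr (by linarith)))
  set G := (ball (0:ℂ) 1).indicator
    (fun z => ENNReal.ofReal ((1 - ‖z‖) ^ α * ‖g z‖ ^ p)) with hGd
  have hG : Measurable G := meas_ind isOpen_ball (hcx hα hg)
  set H := (ball (0:ℂ) 1).indicator
    (fun z => ENNReal.ofReal ((1 - ‖z‖) ^ (α + p) * ‖deriv g z‖ ^ p)) with hHd
  have hH : Measurable H := meas_ind isOpen_ball (hcx (by linarith) (hg.deriv isOpen_ball))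
  refine (lintegral_mono_set hcov).trans_lt ((lintegral_union_le _ _ _).trans_lt ?_)
  rw [ENNReal.add_lt_top]
  constructor
  · calc _ ≤ ∫⁻ z in closedBall (0:ℂ) (1/2), ENNReal.ofReal (1 * M ^ p) := by
          apply setLIntegral_mono' measurableSet_closedBall
          intro z hz
          have hz' : ‖z‖ ≤ 1/2 := by simpa using hz
          have := hM z hz
          gcongr
          exact Real.rpow_le_one (by linarith) (by linarith [norm_nonneg z]) hα
      _ < ⊤ := by
          rw [setLIntegral_const]
          exact ENNReal.mul_lt_top ENNReal.ofReal_lt_top (isCompact_closedBall _ _).measure_lt_top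
  · have e1 : ∫⁻ z in A, ENNReal.ofReal ((1 - ‖z‖) ^ α * ‖g z‖ ^ p) = ∫⁻ z in A, G z := by
      apply setLIntegral_congr_fun hAm
      intro z hz
      simp only [hGd, Set.indicator_of_mem (hAB hz)]
    have e2 : ∫⁻ z in A, H z < ⊤ := by
      refine lt_of_le_of_lt ?_ h
      refine (setLIntegral_le_lintegral _ _).trans ?_
      rw [hHd, lintegral_indicator measurableSet_ball]
    rw [polar_annulus hH (by norm_num)] at e2
    rw [e1, polar_annulus hG (by norm_num)]
    have hmem : ∀ r ∈ Set.Ioo (1/2:ℝ) 1, ∀ θ, circleMap 0 r θ ∈ ball (0:ℂ) 1 := fun r hr θ => by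
      simp [abs_lt, hr.2]; linarith [hr.1]
    have hnorm : ∀ r ∈ Set.Ioo (1/2:ℝ) 1, ∀ θ, ‖circleMap 0 r θ‖ = r := fun r hr θ => by
      simp; linarith [hr.1]
    calc _ ≤ ∫⁻ θ in Set.Ioo (-π) π, (ENNReal.ofReal (2 * (M + 1) ^ p) +
          ENNReal.ofReal (2 * (p * (2 * p) ^ (p - 1))) * (2 *
          ∫⁻ r in Set.Ioo (1/2:ℝ) 1, ENNReal.ofReal r * H (circleMap 0 r θ))) := by
          apply setLIntegral_mono' measurableSet_Ioo
          intro θ _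
          have l1 : ∫⁻ r in Set.Ioo (1/2:ℝ) 1, ENNReal.ofReal r * G (circleMap 0 r θ) ≤
              ∫⁻ r in Set.Ioo (1/2:ℝ) 1,
                ENNReal.ofReal ((1 - r) ^ α * ‖g (circleMap 0 r θ)‖ ^ p) := by
            apply setLIntegral_mono' measurableSet_Ioo
            intro r hr
            rw [hGd, Set.indicator_of_mem (hmem r hr θ), hnorm r hr θ]
            apply mul_le_of_le_one_left zero_le
            rw [ENNReal.ofReal_le_one]; exact hr.2.le
          have l2 : ∫⁻ r in Set.Ioo (1/2:ℝ) 1,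
              ENNReal.ofReal ((1 - r) ^ (α + p) * ‖deriv g (circleMap 0 r θ)‖ ^ p) ≤
              2 * ∫⁻ r in Set.Ioo (1/2:ℝ) 1, ENNReal.ofReal r * H (circleMap 0 r θ) := by
            rw [← lintegral_const_mul' _ _ (by norm_num)]
            apply setLIntegral_mono' measurableSet_Ioo
            intro r hr
            rw [hHd, Set.indicator_of_mem (hmem r hr θ), hnorm r hr θ, ← mul_assoc]
            apply le_mul_of_one_le_left zero_le
            have : (2:ENNReal) = ENNReal.ofReal 2 := by simp
            rw [this, ← ENNReal.ofReal_mul (by norm_num), ENNReal.one_le_ofReal]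
            linarith [hr.1]
          refine l1.trans ((radial hα hp hg hM θ).trans ?_)
          gcongr
      _ < ⊤ := by
          rw [lintegral_add_left measurable_const, setLIntegral_const,
            lintegral_const_mul' _ _ ENNReal.ofReal_ne_top, lintegral_const_mul' _ _ (by norm_num)]
          rw [ENNReal.add_lt_top]
          refine ⟨ENNReal.mul_lt_top ENNReal.ofReal_lt_top (by simp), ?_⟩
          exact ENNReal.mul_lt_top ENNReal.ofReal_lt_top (ENNReal.mul_lt_top (by norm_num) e2)

lemma iter_diff {f : ℂ → ℂ} (hf : DifferentiableOn ℂ f (ball (0 : ℂ) 1)) (n : ℕ) :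
    DifferentiableOn ℂ (iteratedDerivWithin n f (ball (0 : ℂ) 1)) (ball (0 : ℂ) 1) := by
  induction n with
  | zero => simpa [iteratedDerivWithin_zero] using hf
  | succ n ih =>
    rw [iteratedDerivWithin_succ]
    exact (ih.deriv isOpen_ball).congr (fun z hz => derivWithin_of_isOpen isOpen_ball hz)

lemma iter_iff {f : ℂ → ℂ} (hf : DifferentiableOn ℂ f (ball (0 : ℂ) 1)) {p : ℝ} (hp : 1 ≤ p)
    (n : ℕ) :
    ∫⁻ z in ball (0:ℂ) 1, ENNReal.ofReal (‖f z‖ ^ p) < ⊤ ↔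
    ∫⁻ z in ball (0:ℂ) 1, ENNReal.ofReal ((1 - ‖z‖) ^ ((n:ℝ) * p) *
      ‖iteratedDerivWithin n f (ball (0 : ℂ) 1) z‖ ^ p) < ⊤ := by
  induction n with
  | zero => simp [iteratedDerivWithin_zero]
  | succ n ih =>
    rw [ih]
    have hα : 0 ≤ (n:ℝ) * p := by positivity
    have e : ((n + 1 : ℕ) : ℝ) * p = n * p + p := by push_cast; ring
    have e2 : ∫⁻ z in ball (0:ℂ) 1, ENNReal.ofReal ((1 - ‖z‖) ^ (((n+1:ℕ):ℝ) * p) *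
      ‖iteratedDerivWithin (n+1) f (ball (0 : ℂ) 1) z‖ ^ p) =
      ∫⁻ z in ball (0:ℂ) 1, ENNReal.ofReal ((1 - ‖z‖) ^ ((n:ℝ) * p + p) *
      ‖deriv (iteratedDerivWithin n f (ball (0 : ℂ) 1)) z‖ ^ p) := by
      apply setLIntegral_congr_fun measurableSet_ball
      intro z hz
      simp only [e, iteratedDerivWithin_succ, derivWithin_of_isOpen isOpen_ball hz]
    rw [e2]
    exact ⟨fwd hα hp (iter_diff hf n), bwd hα hp (iter_diff hf n)⟩

/-- Characterization of `A^p(Δ)` by derivatives: for `n ≥ 1`, `1 ≤ p < ∞` and `f` analytic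
on the unit disc, `f ∈ A^p(Δ)` if and only if `z ↦ (1-|z|²)ⁿ f⁽ⁿ⁾(z)` belongs to
`L^p(Δ, dm)`, i.e. `∫_Δ (1-|z|²)^{np} |f⁽ⁿ⁾(z)|^p dm(z) < ∞`. -/
theorem Ap_characterization_by_derivatives
    (n : ℕ) (hn : 1 ≤ n) (p : ℝ) (hp : 1 ≤ p) (f : ℂ → ℂ)
    (hf : DifferentiableOn ℂ f (ball (0 : ℂ) 1)) :
    IntegrableOn (fun z => ‖f z‖ ^ p) (ball (0 : ℂ) 1) ↔
    IntegrableOn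
      (fun z => (1 - ‖z‖ ^ 2) ^ ((n : ℝ) * p) *
        ‖iteratedDerivWithin n f (ball (0 : ℂ) 1) z‖ ^ p)
      (ball (0 : ℂ) 1) := by
  have hint : ∀ φ : ℂ → ℝ, ContinuousOn φ (ball (0:ℂ) 1) → (∀ z ∈ ball (0:ℂ) 1, 0 ≤ φ z) →
      (IntegrableOn φ (ball (0:ℂ) 1) ↔ ∫⁻ z in ball (0:ℂ) 1, ENNReal.ofReal (φ z) < ⊤) := by
    intro φ hφ h0
    rw [IntegrableOn, Integrable, and_iff_right (hφ.aestronglyMeasurable measurableSet_ball),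
      hasFiniteIntegral_iff_ofReal]
    filter_upwards [ae_restrict_mem measurableSet_ball] with z hz using h0 z hz
  have hα : 0 ≤ (n:ℝ) * p := by positivity
  have hδ : ∀ z ∈ ball (0:ℂ) 1, ‖z‖ < 1 := fun z hz => by simpa using hz
  have hg := iter_diff hf n
  set g := iteratedDerivWithin n f (ball (0 : ℂ) 1) with hgd
  rw [hint _ (hf.continuousOn.norm.rpow_const (fun _ _ => Or.inr (by linarith)))
    (fun z _ => by positivity),
    hint (fun z => (1 - ‖z‖ ^ 2) ^ ((n : ℝ) * p) * ‖g z‖ ^ p) ((ContinuousOn.rpow_const (by fun_prop) (fun _ _ => Or.inr hα)).mul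
      (hg.continuousOn.norm.rpow_const (fun _ _ => Or.inr (by linarith))))
    (fun z hz => mul_nonneg (Real.rpow_nonneg (by nlinarith [hδ z hz, norm_nonneg z]) _)
      (by positivity)), iter_iff hf hp n]
  constructor
  · intro h
    have h2 : ∫⁻ z in ball (0:ℂ) 1, ENNReal.ofReal ((1 - ‖z‖ ^ 2) ^ ((n:ℝ) * p) * ‖g z‖ ^ p) ≤
        ∫⁻ z in ball (0:ℂ) 1, ENNReal.ofReal (2 ^ ((n:ℝ) * p)) *
          ENNReal.ofReal ((1 - ‖z‖) ^ ((n:ℝ) * p) * ‖g z‖ ^ p) := by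
      apply setLIntegral_mono' measurableSet_ball
      intro z hz
      have h1 := hδ z hz
      have h3 := norm_nonneg z
      rw [← ENNReal.ofReal_mul (by positivity), ← mul_assoc,
        ← Real.mul_rpow (by norm_num) (by linarith)]
      gcongr
      · nlinarith
      · nlinarith
    refine h2.trans_lt ?_
    rw [lintegral_const_mul' _ _ ENNReal.ofReal_ne_top]
    exact ENNReal.mul_lt_top ENNReal.ofReal_lt_top h
  · intro h
    refine lt_of_le_of_lt ?_ h
    apply setLIntegral_mono' measurableSet_ball
    intro z hz
    have h1 := hδ z hz
    have h3 := norm_nonneg z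
    gcongr
    nlinarith
end
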